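/- For every integer n ≥ 3, the bigrassmannian statistic β is sign-balanced on S_n: Σ_{w ∈ S_n} (−1)^{ℓ(w)} β(w) = 0. -/

import Mathlib

/-- The length ℓ(w) = |N(w)|, the number of inversions of `w`, where
N(w) = {(i,j) : i < j and w⁻¹(i) > w⁻¹(j)}. -/
def permLen {n : ℕ} (w : Equiv.Perm (Fin n)) : ℕ :=
  (Finset.univ.filter
    (fun p : Fin n × Fin n => p.1 < p.2 ∧ w⁻¹ p.2 < w⁻¹ p.1)).card

/-- The bigrassmannian statistic β(w) = Σ_{(i,j)∈N(w)} (j−i). -/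
def permBeta {n : ℕ} (w : Equiv.Perm (Fin n)) : ℕ :=
  ∑ p ∈ Finset.univ.filter
      (fun p : Fin n × Fin n => p.1 < p.2 ∧ w⁻¹ p.2 < w⁻¹ p.1),
    ((p.2 : ℕ) - (p.1 : ℕ))

/-- The sign of a permutation is determined by the parity of its number of inversions. -/
theorem neg_one_pow_permLen {n : ℕ} (w : Equiv.Perm (Fin n)) :
    (-1 : ℤ) ^ permLen w = (Equiv.Perm.sign w : ℤ) := by
  have hprod : ∏ p : Fin n × Fin n,
      (if p.1 < p.2 ∧ w⁻¹ p.2 < w⁻¹ p.1 then (-1 : ℤˣ) else 1) = Equiv.Perm.sign w := by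
    rw [← Equiv.Perm.sign_inv w, Equiv.Perm.sign_eq_prod_prod_Iio, Fintype.prod_prod_type_right]
    refine Finset.prod_congr rfl fun j _ => ?_
    rw [← Finset.filter_gt_eq_Iio, Finset.prod_filter]
    refine Finset.prod_congr rfl fun i _ => ?_
    by_cases hij : i < j
    · have hne : w⁻¹ i ≠ w⁻¹ j := w⁻¹.injective.ne hij.ne
      rcases hne.lt_or_gt with h | h <;> simp only [hij, h, h.not_gt, true_and, if_true, if_false]
    · simp [hij]
  rw [← hprod, ← Finset.prod_filter, Finset.prod_const]
  simp [permLen]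

/-- A function of the positions of two fixed values has zero signed sum, as soon as
there are two further values to exchange. -/
theorem sum_sign_mul_eq_zero_of_two_values {n : ℕ} (hn : 4 ≤ n) (i j : Fin n)
    (f : Fin n → Fin n → ℤ) :
    ∑ w : Equiv.Perm (Fin n), (Equiv.Perm.sign w : ℤ) * f (w⁻¹ i) (w⁻¹ j) = 0 := by
  have hcard : 1 < (({i, j} : Finset (Fin n))ᶜ).card := by
    have := Finset.card_le_two (a := i) (b := j)
    rw [Finset.card_compl, Fintype.card_fin]
    omega
  obtain ⟨a, ha, b, hb, hab⟩ := Finset.one_lt_card.mp hcard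
  simp only [Finset.mem_compl, Finset.mem_insert, Finset.mem_singleton, not_or] at ha hb
  have key := Equiv.sum_comp (Equiv.mulLeft (Equiv.swap a b))
    (fun w : Equiv.Perm (Fin n) => (Equiv.Perm.sign w : ℤ) * f (w⁻¹ i) (w⁻¹ j))
  simp only [Equiv.coe_mulLeft, mul_inv_rev, Equiv.swap_inv, Equiv.Perm.mul_apply,
    Equiv.swap_apply_of_ne_of_ne (Ne.symm ha.1) (Ne.symm hb.1),
    Equiv.swap_apply_of_ne_of_ne (Ne.symm ha.2) (Ne.symm hb.2),
    Equiv.Perm.sign_mul, Equiv.Perm.sign_swap hab, neg_mul, one_mul, Units.val_neg,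
    Finset.sum_neg_distrib] at key
  linarith

/-- for every n ≥ 3, β is sign-balanced on S_n:
Σ_{w ∈ S_n} (−1)^{ℓ(w)} β(w) = 0 in ℤ. -/
theorem signed_bigrassmannian_stmt9 (n : ℕ) (hn : 3 ≤ n) :
    ∑ w : Equiv.Perm (Fin n), (-1 : ℤ) ^ permLen w * (permBeta w : ℤ) = 0 := by
  rcases hn.eq_or_lt with rfl | hn
  · decide
  · simp only [neg_one_pow_permLen, permBeta, Finset.sum_filter, Nat.cast_sum, Finset.mul_sum]
    rw [Finset.sum_comm]
    refine Finset.sum_eq_zero fun p _ => ?_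
    exact sum_sign_mul_eq_zero_of_two_values hn p.1 p.2
      fun x y => ((if p.1 < p.2 ∧ y < x then (p.2 : ℕ) - (p.1 : ℕ) else 0 : ℕ) : ℤ)
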